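/- (Lemma 2, second part.) Let L ≥ 1, 0 < ρ < 1, and ε = ε_Λ(√(ρ(1−ρ)/(1+(L−1)ρ))). If ε < 1/2 and the second moment of the discrete Gaussian satisfies ∑_{a∈Λ} D_{Λ,√ρ}(a)·a² ≥ ρ(1−2ε), then the differential entropy of the mixture density satisfies −∫_{ℝ^L} f_{X̄_L} ln f_{X̄_L} dx ≥ ½ ln( (2πe)^L (1+(L−1)ρ)(1−ρ)^{L−1} ) − 5ε; equivalently, the gap I(X_L;W) − I(X̄_L;W̄) between the Wyner common information ½ ln(1 + Lρ/(1−ρ)) of the L Gaussian sources and the mutual information of the discretized model is at most 5ε nats. -/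

import Mathlib

open Real Matrix

/-- The centered Gaussian density with standard deviation `σ`. -/
noncomputable def gpdf (σ x : ℝ) : ℝ :=
  (1 / (Real.sqrt (2 * Real.pi) * σ)) * Real.exp (-(x ^ 2) / (2 * σ ^ 2))

/-- The discrete Gaussian distribution over the lattice `Λ = bℤ` with parameter `σ`,
evaluated at the lattice point `b * k`. -/
noncomputable def dgauss (b σ : ℝ) (k : ℤ) : ℝ :=
  gpdf σ (b * k) / ∑' j : ℤ, gpdf σ (b * j)

/-- The flatness factor of the lattice `Λ = bℤ` at parameter `σ`. -/
noncomputable def flatness (b σ : ℝ) : ℝ :=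
  ⨆ x : ℝ, |b * (∑' k : ℤ, gpdf σ (x - b * k)) - 1|

/-- The `L×L` covariance matrix with unit diagonal and off-diagonal entries `ρ`. -/
def KL (L : ℕ) (ρ : ℝ) : Matrix (Fin L) (Fin L) ℝ :=
  Matrix.of fun i j => if i = j then (1 : ℝ) else ρ

/-- The centered `L`-variate Gaussian density with covariance matrix `K_L`. -/
noncomputable def fXL (L : ℕ) (ρ : ℝ) (x : Fin L → ℝ) : ℝ :=
  (1 / Real.sqrt ((2 * Real.pi) ^ L * (KL L ρ).det)) *
    Real.exp (-(1 / 2) * (x ⬝ᵥ ((KL L ρ)⁻¹ *ᵥ x)))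

/-- The density of `X̄ᵢ = W̄ + √(1-ρ)Nᵢ`, `i = 1,…,L`, with `W̄ ~ D_{Λ,√ρ}`, `Λ = bℤ`. -/
noncomputable def fXbarL (L : ℕ) (ρ b : ℝ) (x : Fin L → ℝ) : ℝ :=
  ∑' k : ℤ, dgauss b (Real.sqrt ρ) k * ∏ i, gpdf (Real.sqrt (1 - ρ)) (x i - b * k)

open MeasureTheory ProbabilityTheory

lemma gpdf_pos {σ : ℝ} (hσ : 0 < σ) (x : ℝ) : 0 < gpdf σ x := by
  unfold gpdf
  positivity

lemma gpdf_sub_eq_gaussianPDFReal {σ : ℝ} (hσ : 0 < σ) (a : ℝ) :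
    (fun t => gpdf σ (t - a)) = gaussianPDFReal a (σ ^ 2).toNNReal := by
  ext t
  rw [gpdf, gaussianPDFReal, Real.coe_toNNReal _ (sq_nonneg σ),
    Real.sqrt_mul (by positivity : 0 ≤ 2 * Real.pi), Real.sqrt_sq hσ.le, one_div]

lemma integrable_pow_mul_gpdf {σ : ℝ} (hσ : 0 < σ) (a : ℝ) (n : ℕ) :
    Integrable (fun t => t ^ n * gpdf σ (t - a)) := by
  have hv : (σ ^ 2).toNNReal ≠ 0 := by positivity
  have h := (memLp_id_gaussianReal (μ := a) (v := (σ ^ 2).toNNReal) n).integrable_norm_pow'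
  have h2 : Integrable (fun t : ℝ => t ^ n) (gaussianReal a (σ ^ 2).toNNReal) := by
    refine h.mono (by fun_prop) (Filter.Eventually.of_forall fun t => ?_)
    simp
  rw [gaussianReal_of_var_ne_zero _ hv,
    integrable_withDensity_iff_integrable_smul' (by fun_prop) (by simp [gaussianPDF])] at h2
  refine h2.congr (Filter.Eventually.of_forall fun t => ?_)
  have := congrFun (gpdf_sub_eq_gaussianPDFReal hσ a) t
  simp only [toReal_gaussianPDF, smul_eq_mul] at this ⊢
  rw [this, mul_comm]

lemma integral_mul_gpdf {σ : ℝ} (hσ : 0 < σ) (a : ℝ) (f : ℝ → ℝ) :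
    ∫ t, f t * gpdf σ (t - a) = ∫ t, f t ∂gaussianReal a (σ ^ 2).toNNReal := by
  have hv : (σ ^ 2).toNNReal ≠ 0 := by positivity
  rw [integral_gaussianReal_eq_integral_smul hv, ← gpdf_sub_eq_gaussianPDFReal hσ]
  simp [mul_comm]

lemma integral_gpdf_sub {σ : ℝ} (hσ : 0 < σ) (a : ℝ) : ∫ t, gpdf σ (t - a) = 1 := by
  simpa using integral_mul_gpdf hσ a (fun _ => 1)

lemma integral_id_mul_gpdf {σ : ℝ} (hσ : 0 < σ) (a : ℝ) : ∫ t, t * gpdf σ (t - a) = a := by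
  rw [integral_mul_gpdf hσ a (fun t => t), integral_id_gaussianReal]

lemma integral_sq_mul_gpdf {σ : ℝ} (hσ : 0 < σ) (a : ℝ) :
    ∫ t, t * t * gpdf σ (t - a) = σ ^ 2 + a ^ 2 := by
  have h := variance_eq_sub (memLp_id_gaussianReal (μ := a) (v := (σ ^ 2).toNNReal) 2)
  rw [variance_id_gaussianReal, Real.coe_toNNReal _ (sq_nonneg σ)] at h
  simp only [Pi.pow_apply, id, integral_id_gaussianReal] at h
  simp only [← sq]
  rw [integral_mul_gpdf hσ a (fun t => t ^ 2)]
  linarith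

lemma summable_exp_neg_mul_int_sq {c : ℝ} (hc : 0 < c) :
    Summable fun k : ℤ => Real.exp (-c * (k : ℝ) ^ 2) := by
  have h := summable_pow_mul_jacobiTheta₂_term_bound 0 (div_pos hc Real.pi_pos) 0
  refine h.congr fun k => ?_
  simp only [pow_zero, one_mul]
  congr 1
  field_simp
  ring

lemma exists_gpdf_bound {b σ : ℝ} (hb : 0 < b) (hσ : 0 < σ) :
    ∃ C, ∀ x, Summable (fun k : ℤ => gpdf σ (x - b * k)) ∧ ∑' k : ℤ, gpdf σ (x - b * k) ≤ C := by
  let g : ℤ → ℝ := fun k => (1 / (Real.sqrt (2 * Real.pi) * σ)) *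
    (Real.exp (b ^ 2 / (2 * σ ^ 2)) * Real.exp (-(b ^ 2 / (4 * σ ^ 2)) * (k : ℝ) ^ 2))
  have hg : Summable g :=
    ((summable_exp_neg_mul_int_sq (by positivity)).mul_left _).mul_left _
  have key : ∀ y : ℝ, 0 ≤ y → y ≤ b → ∀ k : ℤ, gpdf σ (y - b * k) ≤ g k := by
    intro y hy hyb k
    simp only [gpdf, g, ← Real.exp_add]
    gcongr
    have : b ^ 2 / (2 * σ ^ 2) + -(b ^ 2 / (4 * σ ^ 2)) * (k : ℝ) ^ 2
        - -(y - b * k) ^ 2 / (2 * σ ^ 2)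
        = ((b ^ 2 - y ^ 2) + (2 * y - b * k) ^ 2 / 2) / (2 * σ ^ 2) := by
      field_simp
      ring
    have h2 : 0 ≤ b ^ 2 - y ^ 2 := by nlinarith
    have : 0 ≤ ((b ^ 2 - y ^ 2) + (2 * y - b * k) ^ 2 / 2) / (2 * σ ^ 2) := by positivity
    linarith
  refine ⟨∑' k, g k, fun x => ?_⟩
  let n : ℤ := ⌊x / b⌋
  let y := x - b * n
  have hy : 0 ≤ y := by
    have := (le_div_iff₀ hb).1 (Int.floor_le (x / b))
    simp only [y, n]; linarith
  have hyb : y ≤ b := by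
    have := (div_lt_iff₀ hb).1 (Int.lt_floor_add_one (x / b))
    simp only [y, n]; linarith
  have hs : Summable fun k : ℤ => gpdf σ (y - b * k) :=
    Summable.of_nonneg_of_le (fun k => (gpdf_pos hσ _).le) (key y hy hyb) hg
  have he : (fun k : ℤ => gpdf σ (y - b * k)) =
      (fun k : ℤ => gpdf σ (x - b * k)) ∘ Equiv.addRight n := by
    ext k
    simp only [Function.comp, Equiv.coe_addRight, Int.cast_add, y]
    congr 1
    ring
  have hle := hs.tsum_le_tsum (key y hy hyb) hg
  rw [he] at hs hle
  exact ⟨(Equiv.addRight n).summable_iff.1 hs,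
    ((Equiv.addRight n).tsum_eq (fun k : ℤ => gpdf σ (x - b * k))).symm.le.trans hle⟩

lemma summable_gpdf {b σ : ℝ} (hb : 0 < b) (hσ : 0 < σ) (x : ℝ) :
    Summable (fun k : ℤ => gpdf σ (x - b * k)) :=
  ((exists_gpdf_bound hb hσ).choose_spec x).1

lemma gpdf_neg (σ x : ℝ) : gpdf σ (-x) = gpdf σ x := by
  simp [gpdf]

lemma summable_gpdf_lattice {b σ : ℝ} (hb : 0 < b) (hσ : 0 < σ) :
    Summable (fun k : ℤ => gpdf σ (b * k)) := by
  simpa [gpdf_neg] using summable_gpdf hb hσ 0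

lemma tsum_gpdf_lattice_pos {b σ : ℝ} (hb : 0 < b) (hσ : 0 < σ) :
    0 < ∑' k : ℤ, gpdf σ (b * k) :=
  (summable_gpdf_lattice hb hσ).tsum_pos (fun _ => (gpdf_pos hσ _).le) 0 (gpdf_pos hσ _)

lemma abs_sub_one_le_flatness {b σ : ℝ} (hb : 0 < b) (hσ : 0 < σ) (x : ℝ) :
    |b * (∑' k : ℤ, gpdf σ (x - b * k)) - 1| ≤ flatness b σ := by
  obtain ⟨C, hC⟩ := exists_gpdf_bound hb hσ
  refine le_ciSup (f := fun x : ℝ => |b * (∑' k : ℤ, gpdf σ (x - b * k)) - 1|)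
    ⟨b * C + 1, ?_⟩ x
  rintro _ ⟨y, rfl⟩
  have h0 : 0 ≤ ∑' k : ℤ, gpdf σ (y - b * k) := tsum_nonneg fun _ => (gpdf_pos hσ _).le
  have h1 := mul_le_mul_of_nonneg_left (hC y).2 hb.le
  have h2 := mul_nonneg hb.le h0
  simp only [abs_le]
  constructor <;> linarith

lemma gpdf_mul_gpdf {s t : ℝ} (hs : 0 < s) (ht : 0 < t) (a y : ℝ) :
    gpdf t y * gpdf s (y - a) = gpdf (Real.sqrt (s ^ 2 + t ^ 2)) a *
      gpdf (s * t / Real.sqrt (s ^ 2 + t ^ 2)) (y - t ^ 2 / (s ^ 2 + t ^ 2) * a) := by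
  have hr : 0 < Real.sqrt (s ^ 2 + t ^ 2) := by positivity
  have hr2 : Real.sqrt (s ^ 2 + t ^ 2) ^ 2 = s ^ 2 + t ^ 2 := Real.sq_sqrt (by positivity)
  simp only [gpdf, div_pow, mul_pow, hr2]
  rw [mul_mul_mul_comm, ← Real.exp_add,
    mul_mul_mul_comm (1 / (Real.sqrt (2 * Real.pi) * Real.sqrt (s ^ 2 + t ^ 2))), ← Real.exp_add]
  congr 1
  · field_simp
  · congr 1
    field_simp
    ring

/-- The lattice sum of a Gaussian is at least `1` minus the flatness factor at a smaller scale. -/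
lemma one_sub_flatness_le {b s r : ℝ} (hb : 0 < b) (hs : 0 < s) (hsr : s < r) :
    1 - flatness b s ≤ b * ∑' k : ℤ, gpdf r (b * k) := by
  have hr : 0 < r := hs.trans hsr
  set t := Real.sqrt (r ^ 2 - s ^ 2) with ht_def
  have hpos : 0 < r ^ 2 - s ^ 2 := by nlinarith
  have ht : 0 < t := Real.sqrt_pos.2 hpos
  have hrt : Real.sqrt (s ^ 2 + t ^ 2) = r := by
    rw [ht_def, Real.sq_sqrt hpos.le, add_sub_cancel, Real.sqrt_sq hr.le]
  have hw : 0 < s * t / r := by positivity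
  have hF : ∀ k : ℤ, (fun y => gpdf t y * gpdf s (y - b * k)) = fun y => gpdf r (b * k) *
      gpdf (s * t / r) (y - t ^ 2 / (s ^ 2 + t ^ 2) * (b * k)) := by
    intro k
    ext y
    rw [gpdf_mul_gpdf hs ht, hrt]
  have hint : ∀ k : ℤ, ∫ y, gpdf t y * gpdf s (y - b * k) = gpdf r (b * k) := by
    intro k
    rw [hF, integral_const_mul, integral_gpdf_sub hw, mul_one]
  have hInt : ∀ k : ℤ, Integrable (fun y => gpdf t y * gpdf s (y - b * k)) := by
    intro k
    rw [hF]
    simpa using (integrable_pow_mul_gpdf hw (t ^ 2 / (s ^ 2 + t ^ 2) * (b * k)) 0).const_mul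
      (gpdf r (b * k))
  have hsum := integral_tsum_of_summable_integral_norm hInt (by
    have : ∀ k : ℤ, ∫ y, ‖gpdf t y * gpdf s (y - b * k)‖ = gpdf r (b * k) := by
      intro k
      rw [← hint k]
      refine integral_congr_ae (Filter.Eventually.of_forall fun y => ?_)
      exact Real.norm_of_nonneg (mul_pos (gpdf_pos ht _) (gpdf_pos hs _)).le
    simp only [this]
    exact summable_gpdf_lattice hb hr)
  simp only [hint, tsum_mul_left] at hsum
  have hθ : Integrable (fun y => gpdf t y * ∑' k : ℤ, gpdf s (y - b * k)) :=
    .of_integral_ne_zero (hsum ▸ (tsum_gpdf_lattice_pos hb hr).ne')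
  have hg1 : ∫ y, gpdf t y = 1 := by simpa using integral_gpdf_sub ht 0
  have hgI : Integrable (gpdf t) := by simpa using integrable_pow_mul_gpdf ht 0 0
  rw [hsum, ← integral_const_mul]
  calc 1 - flatness b s = ∫ y, (1 - flatness b s) * gpdf t y := by
        rw [integral_const_mul, hg1, mul_one]
    _ ≤ _ := by
        refine integral_mono (hgI.const_mul _) (hθ.const_mul _) fun y => ?_
        have h := (abs_le.1 (abs_sub_one_le_flatness hb hs y)).1
        have := mul_le_mul_of_nonneg_left (neg_le_sub_iff_le_add.1 h) (gpdf_pos ht y).le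
        simp only
        nlinarith

section Product

variable {ι : Type*} [Fintype ι]

lemma integral_prod_gpdf {s : ℝ} (hs : 0 < s) (a : ℝ) :
    ∫ x : ι → ℝ, ∏ k, gpdf s (x k - a) = 1 := by
  rw [integral_fintype_prod_volume_eq_prod (fun _ t => gpdf s (t - a))]
  simp [integral_gpdf_sub hs a]

lemma integrable_prod_gpdf {s : ℝ} (hs : 0 < s) (a : ℝ) :
    Integrable (fun x : ι → ℝ => ∏ k, gpdf s (x k - a)) := by
  refine Integrable.fintype_prod (f := fun _ t => gpdf s (t - a)) fun k => ?_
  simpa using integrable_pow_mul_gpdf hs a 0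

variable [DecidableEq ι]

lemma coord_mul_coord_mul_prod_gpdf (s a : ℝ) (i j : ι) (x : ι → ℝ) :
    x i * x j * ∏ k, gpdf s (x k - a) =
      ∏ k, (if k = i then x k else 1) * (if k = j then x k else 1) * gpdf s (x k - a) := by
  rw [Finset.prod_mul_distrib, Finset.prod_mul_distrib]
  simp

lemma integrable_coord_mul_coord_mul_prod_gpdf {s : ℝ} (hs : 0 < s) (a : ℝ) (i j : ι) :
    Integrable (fun x : ι → ℝ => x i * x j * ∏ k, gpdf s (x k - a)) := by
  simp only [coord_mul_coord_mul_prod_gpdf]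
  refine Integrable.fintype_prod (f := fun k t =>
    (if k = i then t else 1) * (if k = j then t else 1) * gpdf s (t - a)) fun k => ?_
  have h0 := integrable_pow_mul_gpdf hs a 0
  have h1 := integrable_pow_mul_gpdf hs a 1
  have h2 := integrable_pow_mul_gpdf hs a 2
  simp only [pow_zero, pow_one, one_mul, sq] at h0 h1 h2
  split_ifs <;> simpa

lemma integral_coord_mul_coord_mul_prod_gpdf {s : ℝ} (hs : 0 < s) (a : ℝ) (i j : ι) :
    ∫ x : ι → ℝ, x i * x j * ∏ k, gpdf s (x k - a) = (if i = j then s ^ 2 else 0) + a ^ 2 := by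
  simp only [coord_mul_coord_mul_prod_gpdf]
  rw [integral_fintype_prod_volume_eq_prod (fun k t =>
    (if k = i then t else 1) * (if k = j then t else 1) * gpdf s (t - a))]
  split_ifs with hij
  · subst hij
    rw [Finset.prod_eq_single i]
    · simpa using integral_sq_mul_gpdf hs a
    · intro k _ hk
      simpa [hk] using integral_gpdf_sub hs a
    · simp
  · have : ∀ k, ∫ t, (if k = i then t else 1) * (if k = j then t else 1) * gpdf s (t - a) =
        (if k = i then a else 1) * (if k = j then a else 1) := by
      intro k
      split_ifs with h1 h2 h2
      · exact absurd (h1.symm.trans h2) hij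
      all_goals simp [integral_id_mul_gpdf hs a, integral_gpdf_sub hs a]
    simp only [this]
    rw [Finset.prod_mul_distrib]
    simp [sq]

end Product

/-- The scale of the Gaussian obtained from the factor at scale `√ρ` and `L` factors at scale
`√(1-ρ)` by completing the square. -/
noncomputable def condScale (L : ℕ) (ρ : ℝ) : ℝ :=
  Real.sqrt (ρ * (1 - ρ) / (1 + ((L : ℝ) - 1) * ρ))

/-- The quadratic form `xᵀ K_L⁻¹ x`. -/
noncomputable def quadForm (L : ℕ) (ρ : ℝ) (x : Fin L → ℝ) : ℝ :=
  (∑ i, x i * x i - ρ / (1 + ((L : ℝ) - 1) * ρ) * ∑ i, ∑ j, x i * x j) / (1 - ρ)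

/-- The normalizing constant of the Gaussian density with covariance matrix `K_L`. -/
noncomputable def normConst (L : ℕ) (ρ : ℝ) : ℝ :=
  (1 / (Real.sqrt (2 * Real.pi) * Real.sqrt (1 - ρ))) ^ L * (condScale L ρ / Real.sqrt ρ)

section Mixture

variable {L : ℕ} {ρ : ℝ}

lemma covDenom_pos (hL : 1 ≤ L) (hρ0 : 0 < ρ) : 0 < 1 + ((L : ℝ) - 1) * ρ := by
  have : (1 : ℝ) ≤ L := by exact_mod_cast hL
  have := mul_nonneg (sub_nonneg.2 this) hρ0.le
  linarith

lemma condScale_pos (hL : 1 ≤ L) (hρ0 : 0 < ρ) (hρ1 : ρ < 1) : 0 < condScale L ρ :=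
  Real.sqrt_pos.2 (div_pos (mul_pos hρ0 (sub_pos.2 hρ1)) (covDenom_pos hL hρ0))

lemma condScale_lt (hL : 1 ≤ L) (hρ0 : 0 < ρ) : condScale L ρ < Real.sqrt ρ := by
  have hD := covDenom_pos hL hρ0
  have : (1 : ℝ) ≤ L := by exact_mod_cast hL
  refine (Real.sqrt_lt_sqrt_iff_of_pos hρ0).2 ?_
  rw [div_lt_iff₀ hD]
  refine mul_lt_mul_of_pos_left ?_ hρ0
  nlinarith

lemma normConst_pos (hL : 1 ≤ L) (hρ0 : 0 < ρ) (hρ1 : ρ < 1) : 0 < normConst L ρ := by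
  have := condScale_pos hL hρ0 hρ1
  have := sub_pos.2 hρ1
  unfold normConst
  positivity

lemma log_normConst (hL : 1 ≤ L) (hρ0 : 0 < ρ) (hρ1 : ρ < 1) :
    Real.log (normConst L ρ) = L / 2 - (1 / 2) * Real.log ((2 * Real.pi * Real.exp 1) ^ L *
      (1 + ((L : ℝ) - 1) * ρ) * (1 - ρ) ^ (L - 1)) := by
  have hD := covDenom_pos hL hρ0
  have h1 := sub_pos.2 hρ1
  have hπ := Real.pi_pos
  unfold normConst condScale
  rw [Real.log_mul (by positivity) (by positivity), Real.log_pow, one_div, Real.log_inv,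
    Real.log_mul (by positivity) (by positivity), Real.log_div (by positivity) (by positivity),
    Real.log_sqrt (by positivity), Real.log_sqrt h1.le, Real.log_sqrt (by positivity),
    Real.log_sqrt hρ0.le, Real.log_div (by positivity) hD.ne', Real.log_mul hρ0.ne' h1.ne',
    Real.log_mul (by positivity : (2 * Real.pi * Real.exp 1) ^ L * _ ≠ 0) (by positivity),
    Real.log_mul (by positivity) hD.ne', Real.log_pow, Real.log_pow,
    Real.log_mul (by positivity : 2 * Real.pi ≠ 0) (by positivity), Real.log_exp,
    Nat.cast_sub hL]
  push_cast
  ring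

lemma quadForm_nonneg (hL : 1 ≤ L) (hρ0 : 0 < ρ) (hρ1 : ρ < 1) (x : Fin L → ℝ) :
    0 ≤ quadForm L ρ x := by
  have hD := covDenom_pos hL hρ0
  refine div_nonneg (sub_nonneg.2 ?_) (sub_pos.2 hρ1).le
  have hcs := sq_sum_le_card_mul_sum_sq (s := Finset.univ) (f := x)
  simp only [sq, Finset.sum_mul_sum, Finset.card_univ, Fintype.card_fin] at hcs
  have h0 : 0 ≤ ∑ i, x i * x i := Finset.sum_nonneg fun i _ => mul_self_nonneg (x i)
  rw [div_mul_eq_mul_div, div_le_iff₀ hD]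
  have h1 := mul_le_mul_of_nonneg_left hcs hρ0.le
  have h2 := mul_nonneg h0 (sub_pos.2 hρ1).le
  nlinarith

/-- Completing the square in the joint density of the lattice point and the observations. -/
lemma gpdf_mul_prod_gpdf (hL : 1 ≤ L) (hρ0 : 0 < ρ) (hρ1 : ρ < 1) (a : ℝ) (x : Fin L → ℝ) :
    gpdf (Real.sqrt ρ) a * ∏ i, gpdf (Real.sqrt (1 - ρ)) (x i - a) =
      normConst L ρ * Real.exp (-(1 / 2) * quadForm L ρ x) *
        gpdf (condScale L ρ) (ρ / (1 + ((L : ℝ) - 1) * ρ) * (∑ i, x i) - a) := by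
  have hD := covDenom_pos hL hρ0
  have h1 := sub_pos.2 hρ1
  have hσ := condScale_pos hL hρ0 hρ1
  have hσ2 : condScale L ρ ^ 2 = ρ * (1 - ρ) / (1 + ((L : ℝ) - 1) * ρ) :=
    Real.sq_sqrt (div_pos (mul_pos hρ0 h1) hD).le
  have hs : ∑ i, (x i - a) ^ 2 = ∑ i, x i * x i - 2 * a * ∑ i, x i + L * a ^ 2 := by
    simp only [sub_sq, Finset.sum_add_distrib, Finset.sum_sub_distrib, Finset.mul_sum]
    simp only [sq, Finset.sum_const, Finset.card_univ, Fintype.card_fin, nsmul_eq_mul]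
    congr 2
    exact Finset.sum_congr rfl fun i _ => by ring
  simp only [gpdf, Finset.prod_mul_distrib, ← Real.exp_sum, Finset.prod_const, Finset.card_univ,
    Fintype.card_fin, Real.sq_sqrt hρ0.le, Real.sq_sqrt h1.le, hσ2, ← Finset.sum_div,
    Finset.sum_neg_distrib, hs, quadForm, normConst, ← Finset.sum_mul_sum]
  generalize ∑ i, x i * x i = S₂
  generalize ∑ i, x i = S₁
  rw [mul_mul_mul_comm, ← Real.exp_add, mul_mul_mul_comm
    ((1 / (Real.sqrt (2 * Real.pi) * Real.sqrt (1 - ρ))) ^ L * _), ← Real.exp_add]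
  congr 1
  · have := Real.sqrt_pos.2 hρ0
    field_simp
  · congr 1
    generalize hDd : 1 + ((L : ℝ) - 1) * ρ = D at hD
    field_simp
    rw [← hDd]
    ring

lemma quadForm_mul (x : Fin L → ℝ) (p : ℝ) :
    quadForm L ρ x * p = (∑ i, x i * x i * p -
      ρ / (1 + ((L : ℝ) - 1) * ρ) * ∑ i, ∑ j, x i * x j * p) / (1 - ρ) := by
  simp only [quadForm, ← Finset.sum_mul]
  ring

lemma integrable_quadForm_mul_prod_gpdf {s : ℝ} (hs : 0 < s) (a : ℝ) :
    Integrable (fun x : Fin L → ℝ => quadForm L ρ x * ∏ i, gpdf s (x i - a)) := by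
  have hI := fun i j => integrable_coord_mul_coord_mul_prod_gpdf (ι := Fin L) hs a i j
  simp only [quadForm_mul]
  exact .div_const (.sub (integrable_finsetSum _ fun i _ => hI i i)
    (.const_mul (integrable_finsetSum _ fun i _ => integrable_finsetSum _ fun j _ => hI i j) _)) _

lemma integral_quadForm_mul_prod_gpdf (hL : 1 ≤ L) (hρ0 : 0 < ρ) (hρ1 : ρ < 1) (a : ℝ) :
    ∫ x : Fin L → ℝ, quadForm L ρ x * ∏ i, gpdf (Real.sqrt (1 - ρ)) (x i - a) =
      L + (a ^ 2 - ρ) * (L / (1 + ((L : ℝ) - 1) * ρ)) := by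
  have hD := covDenom_pos hL hρ0
  have h1 := sub_pos.2 hρ1
  have hs := Real.sqrt_pos.2 h1
  have hI := fun i j => integrable_coord_mul_coord_mul_prod_gpdf (ι := Fin L) hs a i j
  simp only [quadForm_mul]
  rw [integral_div, integral_sub (integrable_finsetSum _ fun i _ => hI i i)
      (.const_mul (integrable_finsetSum _ fun i _ => integrable_finsetSum _ fun j _ => hI i j) _),
    integral_const_mul, integral_finsetSum _ fun i _ => hI i i,
    integral_finsetSum _ fun i _ => integrable_finsetSum _ fun j _ => hI i j]
  simp only [integral_finsetSum _ fun j _ => hI _ j,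
    integral_coord_mul_coord_mul_prod_gpdf hs, Real.sq_sqrt h1.le]
  simp only [Finset.sum_add_distrib, Finset.sum_ite_eq, Finset.mem_univ, if_true, Finset.sum_const,
    Finset.card_univ, Fintype.card_fin, nsmul_eq_mul]
  generalize hDd : 1 + ((L : ℝ) - 1) * ρ = D at hD
  field_simp
  rw [← hDd]
  ring

variable {b : ℝ}

lemma dgauss_nonneg (hb : 0 < b) {σ : ℝ} (hσ : 0 < σ) (k : ℤ) : 0 ≤ dgauss b σ k :=
  div_nonneg (gpdf_pos hσ _).le (tsum_gpdf_lattice_pos hb hσ).le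

lemma summable_dgauss (hb : 0 < b) {σ : ℝ} (hσ : 0 < σ) : Summable (dgauss b σ) :=
  (summable_gpdf_lattice hb hσ).div_const _

lemma tsum_dgauss (hb : 0 < b) {σ : ℝ} (hσ : 0 < σ) : ∑' k, dgauss b σ k = 1 := by
  simp only [dgauss, tsum_div_const]
  exact div_self (tsum_gpdf_lattice_pos hb hσ).ne'

/-- Integration of a nonnegative function against the mixture density. -/
lemma integral_mul_fXbarL (hb : 0 < b) (hρ0 : 0 < ρ) (hρ1 : ρ < 1) {g : (Fin L → ℝ) → ℝ}
    (hg : ∀ x, 0 ≤ g x) {M : ℤ → ℝ}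
    (hI : ∀ k : ℤ, Integrable fun x => g x * ∏ i, gpdf (Real.sqrt (1 - ρ)) (x i - b * k))
    (hM : ∀ k : ℤ, ∫ x, g x * ∏ i, gpdf (Real.sqrt (1 - ρ)) (x i - b * k) = M k)
    (hs : Summable fun k => dgauss b (Real.sqrt ρ) k * M k) :
    ∫ x, g x * fXbarL L ρ b x = ∑' k, dgauss b (Real.sqrt ρ) k * M k := by
  have hρ := Real.sqrt_pos.2 hρ0
  have h1 := Real.sqrt_pos.2 (sub_pos.2 hρ1)
  have hint : ∀ k : ℤ, ∫ x, dgauss b (Real.sqrt ρ) k *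
      (g x * ∏ i, gpdf (Real.sqrt (1 - ρ)) (x i - b * k)) = dgauss b (Real.sqrt ρ) k * M k :=
    fun k => by rw [integral_const_mul, hM]
  have h := integral_tsum_of_summable_integral_norm
    (F := fun (k : ℤ) (x : Fin L → ℝ) => dgauss b (Real.sqrt ρ) k *
      (g x * ∏ i, gpdf (Real.sqrt (1 - ρ)) (x i - b * k))) (μ := volume)
    (fun k => (hI k).const_mul _) (by
      refine hs.congr fun k => ?_
      rw [← hint k]
      refine integral_congr_ae (Filter.Eventually.of_forall fun x => ?_)
      exact (Real.norm_of_nonneg (mul_nonneg (dgauss_nonneg hb hρ k) (mul_nonneg (hg x)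
        (Finset.prod_nonneg fun i _ => (gpdf_pos h1 _).le)))).symm)
  simp only [hint] at h
  rw [h]
  refine integral_congr_ae (Filter.Eventually.of_forall fun x => ?_)
  simp only [fXbarL, ← tsum_mul_left]
  exact tsum_congr fun k => by ring

lemma integral_fXbarL (hb : 0 < b) (hρ0 : 0 < ρ) (hρ1 : ρ < 1) :
    ∫ x, fXbarL L ρ b x = 1 := by
  have hρ := Real.sqrt_pos.2 hρ0
  have h1 := Real.sqrt_pos.2 (sub_pos.2 hρ1)
  have h := integral_mul_fXbarL (L := L) hb hρ0 hρ1 (g := fun _ => 1) (M := fun _ => 1)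
    (fun _ => zero_le_one) (fun k => by simpa using integrable_prod_gpdf h1 (b * k))
    (fun k => by simpa using integral_prod_gpdf h1 (b * k))
    (by simpa using summable_dgauss hb hρ)
  simpa [tsum_dgauss hb hρ] using h

lemma integral_quadForm_mul_fXbarL (hL : 1 ≤ L) (hb : 0 < b) (hρ0 : 0 < ρ) (hρ1 : ρ < 1)
    (hm : Summable fun k : ℤ => dgauss b (Real.sqrt ρ) k * (b * k) ^ 2) :
    ∫ x, quadForm L ρ x * fXbarL L ρ b x =
      L + ((∑' k : ℤ, dgauss b (Real.sqrt ρ) k * (b * k) ^ 2) - ρ) *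
        (L / (1 + ((L : ℝ) - 1) * ρ)) := by
  have hρ := Real.sqrt_pos.2 hρ0
  have h1 := Real.sqrt_pos.2 (sub_pos.2 hρ1)
  have hd := summable_dgauss hb hρ
  have he : ∀ k : ℤ, dgauss b (Real.sqrt ρ) k *
      (L + ((b * k) ^ 2 - ρ) * (L / (1 + ((L : ℝ) - 1) * ρ))) =
      dgauss b (Real.sqrt ρ) k * (L - ρ * (L / (1 + ((L : ℝ) - 1) * ρ))) +
      dgauss b (Real.sqrt ρ) k * (b * k) ^ 2 * (L / (1 + ((L : ℝ) - 1) * ρ)) :=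
    fun k => by ring
  rw [integral_mul_fXbarL hb hρ0 hρ1 (quadForm_nonneg hL hρ0 hρ1)
    (fun k => integrable_quadForm_mul_prod_gpdf h1 (b * k))
    (fun k => integral_quadForm_mul_prod_gpdf hL hρ0 hρ1 (b * k))
    (by simpa only [he] using (hd.mul_right _).add (hm.mul_right _))]
  simp only [he]
  rw [(hd.mul_right _).tsum_add (hm.mul_right _), tsum_mul_right, tsum_mul_right,
    tsum_dgauss hb hρ]
  ring

/-- The mixture density as a Gaussian density times a ratio of lattice sums. -/
lemma fXbarL_eq (hL : 1 ≤ L) (hρ0 : 0 < ρ) (hρ1 : ρ < 1) (x : Fin L → ℝ) :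
    fXbarL L ρ b x = normConst L ρ * Real.exp (-(1 / 2) * quadForm L ρ x) *
      ((∑' k : ℤ, gpdf (condScale L ρ) (ρ / (1 + ((L : ℝ) - 1) * ρ) * (∑ i, x i) - b * k)) /
        ∑' k : ℤ, gpdf (Real.sqrt ρ) (b * k)) := by
  simp only [fXbarL, dgauss, div_mul_eq_mul_div, gpdf_mul_prod_gpdf hL hρ0 hρ1, tsum_div_const,
    tsum_mul_left]
  rw [← div_mul_eq_mul_div, mul_div_assoc]
  ring

end Mixture

/-- Lemma 2, second part: if `ε = ε_Λ(√(ρ(1-ρ)/(1+(L-1)ρ))) < 1/2` and the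
second moment of `D_{Λ,√ρ}` is at least `ρ(1-2ε)`, then the differential entropy of the
`L`-variate mixture density is at least `½ ln((2πe)^L (1+(L-1)ρ)(1-ρ)^{L-1}) − 5ε`;
equivalently, the gap `I(X_L;W) − I(X̄_L;W̄)` is at most `5ε` nats. -/
theorem multivariate_mixture_entropy_lower_bound (L : ℕ) (hL : 1 ≤ L) (ρ b : ℝ)
    (hb : 0 < b) (hρ0 : 0 < ρ) (hρ1 : ρ < 1)
    (hε : flatness b (Real.sqrt (ρ * (1 - ρ) / (1 + ((L : ℝ) - 1) * ρ))) < 1 / 2)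
    (hm₂ : (∑' k : ℤ, dgauss b (Real.sqrt ρ) k * (b * k) ^ 2) ≥
      ρ * (1 - 2 * flatness b (Real.sqrt (ρ * (1 - ρ) / (1 + ((L : ℝ) - 1) * ρ))))) :
    -∫ x : Fin L → ℝ, fXbarL L ρ b x * Real.log (fXbarL L ρ b x) ≥
      (1 / 2) * Real.log ((2 * Real.pi * Real.exp 1) ^ L *
          (1 + ((L : ℝ) - 1) * ρ) * (1 - ρ) ^ (L - 1)) -
        5 * flatness b (Real.sqrt (ρ * (1 - ρ) / (1 + ((L : ℝ) - 1) * ρ))) := by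
  change flatness b (condScale L ρ) < 1 / 2 at hε
  change _ ≥ ρ * (1 - 2 * flatness b (condScale L ρ)) at hm₂
  change _ ≥ _ - 5 * flatness b (condScale L ρ)
  have hσ := condScale_pos hL hρ0 hρ1
  have hD := covDenom_pos hL hρ0
  have hc := normConst_pos hL hρ0 hρ1
  have hL1 : (1 : ℝ) ≤ L := by exact_mod_cast hL
  have hε0 : 0 ≤ flatness b (condScale L ρ) :=
    (abs_nonneg _).trans (abs_sub_one_le_flatness hb hσ 0)
  have hZ0 := tsum_gpdf_lattice_pos hb (Real.sqrt_pos.2 hρ0)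
  have hZ := one_sub_flatness_le hb hσ (condScale_lt hL hρ0)
  have hθ := fun y => abs_le.1 (abs_sub_one_le_flatness hb hσ y)
  have hm : Summable fun k : ℤ => dgauss b (Real.sqrt ρ) k * (b * k) ^ 2 := by
    by_contra h
    rw [tsum_eq_zero_of_not_summable h] at hm₂
    nlinarith
  have hlog := log_normConst hL hρ0 hρ1
  have hQ := integral_quadForm_mul_fXbarL hL hb hρ0 hρ1 hm
  have hf := integral_fXbarL (L := L) hb hρ0 hρ1
  set ε := flatness b (condScale L ρ)
  set Z := ∑' k : ℤ, gpdf (Real.sqrt ρ) (b * k)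
  set m₂ := ∑' k : ℤ, dgauss b (Real.sqrt ρ) k * (b * k) ^ 2
  set f := fXbarL L ρ b
  set c := normConst L ρ
  have hQ_ge : L - 2 * ε ≤ ∫ x, quadForm L ρ x * f x := by
    rw [hQ]
    have h1 : ρ * (L / (1 + ((L : ℝ) - 1) * ρ)) ≤ 1 := by
      rw [← mul_div_assoc, div_le_one hD]
      linarith
    have h2 : 0 ≤ (L : ℝ) / (1 + ((L : ℝ) - 1) * ρ) := by positivity
    have h3 := mul_le_mul_of_nonneg_right hm₂ h2
    nlinarith
  have hfI : Integrable f := .of_integral_ne_zero (by rw [hf]; exact one_ne_zero)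
  have hQI : Integrable fun x => quadForm L ρ x * f x := .of_integral_ne_zero (by linarith)
  obtain ⟨r, hfr, hr_lower, hr_upper⟩ : ∃ r : (Fin L → ℝ) → ℝ,
      (∀ x, f x = c * Real.exp (-(1 / 2) * quadForm L ρ x) * r x) ∧
      (∀ x, (1 - ε) / (b * Z) ≤ r x) ∧ ∀ x, r x ≤ 1 + 4 * ε := by
    refine ⟨_, fXbarL_eq hL hρ0 hρ1, fun x => ?_, fun x => ?_⟩
    · rw [← mul_div_mul_left _ Z hb.ne']
      have := (hθ (ρ / (1 + ((L : ℝ) - 1) * ρ) * (∑ i, x i))).1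
      gcongr
      linarith
    · rw [← mul_div_mul_left _ Z hb.ne', div_le_iff₀ (mul_pos hb hZ0)]
      have := (hθ (ρ / (1 + ((L : ℝ) - 1) * ρ) * (∑ i, x i))).2
      nlinarith
  have hr0 : 0 < (1 - ε) / (b * Z) := div_pos (by linarith) (mul_pos hb hZ0)
  have hr_pos : ∀ x, 0 < r x := fun x => hr0.trans_le (hr_lower x)
  have hf_pos : ∀ x, 0 < f x := fun x => by
    rw [hfr]
    have := hr_pos x
    positivity
  have hlogf : ∀ x,
      Real.log (f x) = Real.log c - quadForm L ρ x / 2 + Real.log (r x) := fun x => by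
    rw [hfr, Real.log_mul (by positivity) (hr_pos x).ne', Real.log_mul hc.ne' (by positivity),
      Real.log_exp]
    ring
  have hlogr : ∀ x, Real.log (r x) ≤ 4 * ε := fun x => by
    have := Real.log_le_sub_one_of_pos (hr_pos x)
    linarith [hr_upper x]
  have hlogr' : ∀ x, Real.log ((1 - ε) / (b * Z)) ≤ Real.log (r x) := fun x =>
    Real.log_le_log hr0 (hr_lower x)
  have hB : ∀ C : ℝ, Integrable fun x => C * f x - 1 / 2 * (quadForm L ρ x * f x) := fun C =>
    (hfI.const_mul C).sub (hQI.const_mul _)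
  have hlower : ∀ x, (Real.log c + Real.log ((1 - ε) / (b * Z))) * f x -
      1 / 2 * (quadForm L ρ x * f x) ≤ f x * Real.log (f x) := fun x => by
    have := mul_le_mul_of_nonneg_left (hlogr' x) (hf_pos x).le
    rw [hlogf]
    linarith
  have hupper : ∀ x, f x * Real.log (f x) ≤ (Real.log c + 4 * ε) * f x -
      1 / 2 * (quadForm L ρ x * f x) := fun x => by
    have := mul_le_mul_of_nonneg_left (hlogr x) (hf_pos x).le
    rw [hlogf]
    linarith
  have hI : Integrable fun x => f x * Real.log (f x) :=
    integrable_of_le_of_le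
      (hfI.aemeasurable.mul hfI.aemeasurable.log).aestronglyMeasurable
      (Filter.Eventually.of_forall hlower) (Filter.Eventually.of_forall hupper) (hB _) (hB _)
  have hmain := integral_mono hI (hB _) hupper
  rw [integral_sub (hfI.const_mul _) (hQI.const_mul _), integral_const_mul, integral_const_mul,
    hf] at hmain
  linarith
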